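/- arXiv:2504.19552 — 2 statements merged into one kernel-verified Lean document; each statement's English description precedes it below -/
import Mathlib

section
/- Let F : ℝ → [0,1] be a strictly increasing function. For dyadic subintervals I, J of [0,1], write I ∼ J if I and J have the same length, are not adjacent, have adjacent parents, and I lies to the right of J. Then for almost every pair (t,s) ∈ ℝ², the indicator 1(t - s > 0) equals the sum over pairs I ∼ J of 1_{F^{-1}(J)}(s) · 1_{F^{-1}(I)}(t). -/
open MeasureTheory
open scoped ENNReal

/-- The dyadic subinterval of `[0,1]` of length `2^{-n}` with index `i`
(for `i + 1 ≤ 2^n`), namely `[i·2^{-n}, (i+1)·2^{-n}]`. -/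
noncomputable def dyadicI (n i : ℕ) : Set ℝ :=
  Set.Icc ((i : ℝ) / 2 ^ n) (((i : ℝ) + 1) / 2 ^ n)

/-- For same-level dyadic intervals indexed by `i` and `j`, `I_i ∼ I_j` means: they are
not adjacent, their parents (indices `i/2` and `j/2`) are adjacent, and `I_i` is to the
right of `I_j`; in terms of indices this is `j + 2 ≤ i ∧ i/2 = j/2 + 1`. -/
def dyadicSimRel (i j : ℕ) : Prop :=
  j + 2 ≤ i ∧ i / 2 = j / 2 + 1

/-- let `F : ℝ → [0,1]` be strictly increasing. Then for almost every
`(t,s) ∈ ℝ²`, the indicator `1(t - s > 0)` equals the sum over pairs of dyadic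
subintervals `I ∼ J` of `[0,1]` of `1_{F⁻¹(J)}(s) · 1_{F⁻¹(I)}(t)`. -/
instance : ∀ i j, Decidable (dyadicSimRel i j) := fun i j => by
  unfold dyadicSimRel; infer_instance

theorem dyadicI_mem_iff (x : ℝ) (h0 : 0 ≤ x) (hx : ∀ n k : ℕ, x ≠ (k : ℝ) / 2 ^ n) (n i : ℕ) :
    x ∈ dyadicI n i ↔ i = ⌊x * 2 ^ n⌋₊ := by
  have hp : (0 : ℝ) < 2 ^ n := by positivity
  have h1 := hx n (i + 1)
  push_cast at h1
  rw [eq_comm, Nat.floor_eq_iff (by positivity), dyadicI, Set.mem_Icc, div_le_iff₀ hp,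
    ← lt_div_iff₀ hp]
  constructor
  · rintro ⟨h, h'⟩
    exact ⟨h, lt_of_le_of_ne h' h1⟩
  · rintro ⟨h, h'⟩
    exact ⟨h, h'.le⟩

theorem floor_dyadic_half (x : ℝ) (n : ℕ) : ⌊x * 2 ^ (n + 1)⌋₊ / 2 = ⌊x * 2 ^ n⌋₊ := by
  have h := Nat.floor_div_natCast (x * 2 ^ (n + 1)) 2
  rw [← h]
  congr 1
  push_cast
  rw [pow_succ]
  ring

theorem dyadic_ae_good (F : ℝ → ℝ) (hF : StrictMono F) :
    ∀ᵐ t : ℝ, ∀ n k : ℕ, F t ≠ (k : ℝ) / 2 ^ n := by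
  rw [ae_all_iff]
  intro n
  rw [ae_all_iff]
  intro k
  have hc : (F ⁻¹' {(k : ℝ) / 2 ^ n}).Countable :=
    (Set.countable_singleton _).preimage hF.injective
  filter_upwards [hc.ae_notMem volume] with t ht h
  exact ht h

theorem dyadic_pointwise_sum (x y : ℝ) (hx1 : x < 1) (hy : 0 ≤ y) :
    (if y < x then (1 : ℝ) else 0) =
      ∑' n : ℕ, if dyadicSimRel ⌊x * 2 ^ n⌋₊ ⌊y * 2 ^ n⌋₊ then (1 : ℝ) else 0 := by
  by_cases hyx : y < x
  · have hex : ∃ n : ℕ, ⌊y * 2 ^ n⌋₊ + 2 ≤ ⌊x * 2 ^ n⌋₊ := by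
      obtain ⟨n, hn⟩ := pow_unbounded_of_one_lt (3 / (x - y)) (one_lt_two : (1 : ℝ) < 2)
      rw [div_lt_iff₀ (by linarith)] at hn
      have hp : (0 : ℝ) < 2 ^ n := by positivity
      refine ⟨n, Nat.le_floor ?_⟩
      push_cast
      have := Nat.floor_le (mul_nonneg hy hp.le)
      nlinarith
    classical
    have hmono : ∀ m k : ℕ, ⌊y * 2 ^ m⌋₊ + 2 ≤ ⌊x * 2 ^ m⌋₊ →
        ⌊y * 2 ^ (m + k)⌋₊ + 2 ≤ ⌊x * 2 ^ (m + k)⌋₊ := by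
      intro m k hm
      induction k with
      | zero => exact hm
      | succ k ih =>
        have h1 := floor_dyadic_half x (m + k)
        have h2 := floor_dyadic_half y (m + k)
        rw [← add_assoc]
        omega
    have hspec := Nat.find_spec hex
    have hmin := fun m => @Nat.find_min _ _ hex m
    generalize Nat.find hex = N at hspec hmin
    rw [tsum_eq_single N, if_pos hyx, if_pos]
    · refine ⟨hspec, ?_⟩
      cases N with
      | zero =>
        have : ⌊x * 2 ^ 0⌋₊ = 0 := by simpa using hx1
        omega
      | succ M =>
        have h1 := floor_dyadic_half x M
        have h2 := floor_dyadic_half y M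
        have h3 := hmin M (Nat.lt_succ_self M)
        omega
    · intro n hn
      rw [if_neg]
      rintro ⟨h, h'⟩
      rcases lt_or_gt_of_ne hn with h3 | h3
      · exact hmin n h3 h
      · obtain ⟨k, rfl⟩ := Nat.exists_eq_add_of_lt h3
        have h4 := hmono N k hspec
        rw [floor_dyadic_half, floor_dyadic_half] at h'
        omega
  · rw [if_neg hyx]
    symm
    convert tsum_zero with n
    rw [if_neg]
    rintro ⟨h, -⟩
    have : ⌊x * 2 ^ n⌋₊ ≤ ⌊y * 2 ^ n⌋₊ := by
      apply Nat.floor_le_floor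
      have : x ≤ y := not_lt.mp hyx
      gcongr
    omega

theorem whitney_indicator_decomposition (F : ℝ → ℝ) (hF : StrictMono F)
    (hF01 : ∀ t, F t ∈ Set.Icc (0 : ℝ) 1) :
    ∀ᵐ p : ℝ × ℝ ∂(volume : Measure (ℝ × ℝ)),
      (if 0 < p.1 - p.2 then (1 : ℝ) else 0) =
        ∑' n : ℕ, ∑' i : ℕ, ∑' j : ℕ,
          if i + 1 ≤ 2 ^ n ∧ dyadicSimRel i j then
            Set.indicator (F ⁻¹' dyadicI n j) (fun _ => (1 : ℝ)) p.2 *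
              Set.indicator (F ⁻¹' dyadicI n i) (fun _ => (1 : ℝ)) p.1
          else 0 := by
  have hg := dyadic_ae_good F hF
  have h1 : ∀ᵐ p : ℝ × ℝ ∂(volume : Measure (ℝ × ℝ)), ∀ n k : ℕ, F p.1 ≠ (k : ℝ) / 2 ^ n :=
    Measure.quasiMeasurePreserving_fst.ae hg
  have h2 : ∀ᵐ p : ℝ × ℝ ∂(volume : Measure (ℝ × ℝ)), ∀ n k : ℕ, F p.2 ≠ (k : ℝ) / 2 ^ n :=
    Measure.quasiMeasurePreserving_snd.ae hg
  filter_upwards [h1, h2] with p hx hy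
  have hx1 : F p.1 < 1 := lt_of_le_of_ne (hF01 p.1).2 (by simpa using hx 0 1)
  have hx0 := (hF01 p.1).1
  have hy0 := (hF01 p.2).1
  have hiff : (0 < p.1 - p.2) ↔ F p.2 < F p.1 := by rw [sub_pos, hF.lt_iff_lt]
  rw [if_congr hiff rfl rfl, dyadic_pointwise_sum _ _ hx1 hy0]
  congr 1
  funext n
  have hlt : ⌊F p.1 * 2 ^ n⌋₊ + 1 ≤ 2 ^ n := by
    rw [Nat.succ_le_iff, Nat.floor_lt (by positivity)]
    push_cast
    have hp : (0 : ℝ) < 2 ^ n := by positivity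
    nlinarith
  have hix : ∀ i, Set.indicator (F ⁻¹' dyadicI n i) (fun _ => (1 : ℝ)) p.1 =
      if i = ⌊F p.1 * 2 ^ n⌋₊ then 1 else 0 := by
    intro i
    classical
    rw [Set.indicator_apply]
    exact if_congr (dyadicI_mem_iff _ hx0 hx n i) rfl rfl
  have hiy : ∀ j, Set.indicator (F ⁻¹' dyadicI n j) (fun _ => (1 : ℝ)) p.2 =
      if j = ⌊F p.2 * 2 ^ n⌋₊ then 1 else 0 := by
    intro j
    classical
    rw [Set.indicator_apply]
    exact if_congr (dyadicI_mem_iff _ hy0 hy n j) rfl rfl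
  simp only [hix, hiy]
  rw [tsum_eq_single ⌊F p.1 * 2 ^ n⌋₊, tsum_eq_single ⌊F p.2 * 2 ^ n⌋₊]
  · simp [hlt]
  · intro j hj
    simp [hj]
  · intro i hi
    simp [hi]
end

section
/- Let g : ℝ^d → [0,∞) be an even integrable function with g' := ∂_r g continuous and strictly negative on (0,∞) in dimension d = 1 (i.e. g even on ℝ, g' < 0 on (0,∞)). For τ > 0, ω ∈ ℝ, ξ ≠ 0, define m(τ, ω, ξ) := ∫₀^∞ e^{-tτ} e^{-itω} (sin(t|ξ|)/|ξ|) ĝ(t) dt, where ĝ is the Fourier transform of g. Then the imaginary part satisfies Im m(τ, ω, ξ) = (2/(|ξ|√(2π))) ∫₀^∞ g'(r) ∫_{||ξ|-r|}^{r+|ξ|} (τ ω z)/((τ² + (ω+z)²)(τ² + (ω-z)²)) dz dr; in particular Im m(τ, ω, ξ) ≠ 0 whenever τ > 0, ω ≠ 0, ξ ≠ 0. -/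
open MeasureTheory Complex
open scoped Real

/-- Fourier transform `ĝ(k) = (2π)^{-1/2} ∫ g(r) e^{-ikr} dr` of a function on `ℝ`. -/
noncomputable def fhat (g : ℝ → ℝ) (k : ℝ) : ℂ :=
  ((2 * π : ℝ) ^ (-(1 : ℝ) / 2) : ℝ) * ∫ r : ℝ, (g r : ℂ) * Complex.exp (-Complex.I * k * r)

/-- `m(τ,ω,ξ) = ∫₀^∞ e^{-tτ} e^{-itω} (sin(t|ξ|)/|ξ|) ĝ(t) dt`. -/
noncomputable def penroseM (g : ℝ → ℝ) (τ ω ξ : ℝ) : ℂ :=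
  ∫ t in Set.Ioi (0 : ℝ),
    (Real.exp (-t * τ) : ℂ) * Complex.exp (-Complex.I * t * ω) *
      ((Real.sin (t * |ξ|) / |ξ| : ℝ) : ℂ) * fhat g t

/-- The inner Poisson-kernel integral
`∫_{||ξ|-r|}^{r+|ξ|} (τ ω z)/((τ²+(ω+z)²)(τ²+(ω-z)²)) dz`. -/
noncomputable def penroseInner (τ ω ξ r : ℝ) : ℝ :=
  ∫ z in Set.Icc |(|ξ| - r)| (r + |ξ|),
    (τ * ω * z) / ((τ ^ 2 + (ω + z) ^ 2) * (τ ^ 2 + (ω - z) ^ 2))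

namespace PenroseAux

noncomputable def P (τ x : ℝ) : ℝ := τ / (τ ^ 2 + x ^ 2)

noncomputable def ph (τ ω z : ℝ) : ℝ :=
  (τ * ω * z) / ((τ ^ 2 + (ω + z) ^ 2) * (τ ^ 2 + (ω - z) ^ 2))

lemma den_pos {τ : ℝ} (hτ : 0 < τ) (x : ℝ) : 0 < τ ^ 2 + x ^ 2 := by positivity

lemma ph_eq {τ : ℝ} (hτ : 0 < τ) (ω z : ℝ) :
    ph τ ω z = (P τ (ω - z) - P τ (ω + z)) / 4 := by
  unfold ph P
  have h1 := (den_pos hτ (ω + z)).ne'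
  have h2 := (den_pos hτ (ω - z)).ne'
  field_simp
  ring

lemma ph_neg (τ ω z : ℝ) : ph τ ω (-z) = - ph τ ω z := by
  unfold ph
  rw [← neg_div]
  congr 1 <;> ring

lemma ph_cont {τ : ℝ} (hτ : 0 < τ) (ω : ℝ) : Continuous (ph τ ω) := by
  unfold ph
  refine Continuous.div (by fun_prop) (by fun_prop) fun z => ?_
  exact (mul_pos (den_pos hτ _) (den_pos hτ _)).ne'

lemma P_bd {τ : ℝ} (hτ : 0 < τ) (x : ℝ) : 0 ≤ P τ x ∧ P τ x ≤ 1 / τ := by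
  unfold P
  have := den_pos hτ x
  refine ⟨by positivity, ?_⟩
  rw [div_le_div_iff₀ this hτ]
  nlinarith [sq_nonneg x]

lemma ph_bd {τ : ℝ} (hτ : 0 < τ) (ω z : ℝ) : ‖ph τ ω z‖ ≤ 1 / τ := by
  rw [ph_eq hτ, Real.norm_eq_abs, abs_le]
  obtain ⟨h1, h2⟩ := P_bd hτ (ω - z)
  obtain ⟨h3, h4⟩ := P_bd hτ (ω + z)
  constructor <;> linarith

noncomputable def Ph (τ ω a r : ℝ) : ℝ := ∫ z in (r - a)..(r + a), ph τ ω z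

lemma Ph_eq' {τ : ℝ} (hτ : 0 < τ) (ω a r : ℝ) :
    Ph τ ω a r = ∫ z in (a - r)..(a + r), ph τ ω z := by
  have hc := ph_cont hτ ω
  have hi : ∀ x y, IntervalIntegrable (ph τ ω) volume x y := fun x y => hc.intervalIntegrable x y
  unfold Ph
  rw [← intervalIntegral.integral_add_adjacent_intervals (hi (r - a) (a - r)) (hi (a - r) (r + a)),
    add_comm a r]
  have : ∫ z in (r - a)..(a - r), ph τ ω z = 0 := by
    have h := intervalIntegral.integral_comp_neg (a := r - a) (b := a - r) (ph τ ω)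
    simp only [ph_neg, intervalIntegral.integral_neg, neg_sub] at h
    linarith
  rw [this, zero_add]

lemma inner_eq {τ : ℝ} (hτ : 0 < τ) (ω ξ : ℝ) {r : ℝ} (hr : 0 < r) :
    penroseInner τ ω ξ r = Ph τ ω |ξ| r := by
  have hx := abs_nonneg ξ
  have hle : |(|ξ| - r)| ≤ r + |ξ| := by rw [abs_le]; constructor <;> linarith
  have : penroseInner τ ω ξ r = ∫ z in |(|ξ| - r)|..(r + |ξ|), ph τ ω z := by
    rw [intervalIntegral.integral_of_le hle, ← integral_Icc_eq_integral_Ioc]; rfl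
  rw [this]
  rcases le_total r |ξ| with h | h
  · rw [abs_of_nonneg (by linarith), Ph_eq' hτ, add_comm]
  · rw [abs_of_nonpos (by linarith), neg_sub]; rfl

lemma Ph_bd1 {τ : ℝ} (hτ : 0 < τ) (ω : ℝ) {a : ℝ} (ha : 0 < a) (r : ℝ) :
    ‖Ph τ ω a r‖ ≤ 1 / τ * (2 * a) := by
  have := intervalIntegral.norm_integral_le_of_norm_le_const (a := r - a) (b := r + a)
    (f := ph τ ω) (C := 1 / τ) fun x _ => ph_bd hτ ω x
  rwa [show r + a - (r - a) = 2 * a by ring, abs_of_pos (by linarith)] at this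

lemma Ph_bd2 {τ : ℝ} (hτ : 0 < τ) (ω a : ℝ) {r : ℝ} (hr : 0 < r) :
    ‖Ph τ ω a r‖ ≤ 1 / τ * (2 * r) := by
  have := intervalIntegral.norm_integral_le_of_norm_le_const (a := a - r) (b := a + r)
    (f := ph τ ω) (C := 1 / τ) fun x _ => ph_bd hτ ω x
  rw [Ph_eq' hτ]
  rwa [show a + r - (a - r) = 2 * r by ring, abs_of_pos (by linarith)] at this

lemma Ph_deriv {τ : ℝ} (hτ : 0 < τ) (ω a r : ℝ) :
    HasDerivAt (Ph τ ω a) (ph τ ω (a + r) + ph τ ω (a - r)) r := by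
  have hc := ph_cont hτ ω
  have hi : ∀ x y, IntervalIntegrable (ph τ ω) volume x y := fun x y => hc.intervalIntegrable x y
  have h0 : Ph τ ω a = fun r => (∫ z in (0:ℝ)..(r + a), ph τ ω z) - ∫ z in (0:ℝ)..(r - a), ph τ ω z := by
    ext s
    rw [intervalIntegral.integral_interval_sub_left (hi _ _) (hi _ _)]; rfl
  rw [h0]
  have h1 := (hc.integral_hasStrictDerivAt 0 (r + a)).hasDerivAt.comp_add_const r a
  have h2 := (hc.integral_hasStrictDerivAt 0 (r - a)).hasDerivAt.comp_sub_const r a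
  have h3 := h1.sub h2
  have e : ph τ ω (a + r) + ph τ ω (a - r) = ph τ ω (r + a) - ph τ ω (r - a) := by
    rw [add_comm a r, ← neg_sub r a, ph_neg]; ring
  rw [e]
  exact h3

lemma Ph_pos {τ ω a r : ℝ} (hτ : 0 < τ) (hω : ω ≠ 0) (ha : 0 < a) (hr : 0 < r) :
    0 < ω * Ph τ ω a r := by
  have hc := ph_cont hτ ω
  have key : ∀ x y : ℝ, 0 ≤ x → x < y → 0 < ω * ∫ z in x..y, ph τ ω z := by
    intro x y hx hxy
    rw [← intervalIntegral.integral_const_mul]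
    refine intervalIntegral.intervalIntegral_pos_of_pos_on
      ((continuous_const.mul hc).intervalIntegrable _ _) ?_ hxy
    intro z hz
    have hz0 : 0 < z := lt_of_le_of_lt hx hz.1
    unfold ph
    have h1 := den_pos hτ (ω + z)
    have h2 := den_pos hτ (ω - z)
    have h3 : 0 < ω * ω := mul_self_pos.2 hω
    rw [← mul_div_assoc]
    refine div_pos ?_ (mul_pos h1 h2)
    have : ω * (τ * ω * z) = (ω * ω) * (τ * z) := by ring
    rw [this]; positivity
  rcases le_total r a with h | h
  · rw [Ph_eq' hτ]; exact key _ _ (by linarith) (by linarith)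
  · exact key _ _ (by linarith) (by linarith)

/-- kernel after swapping -/
lemma kernel_im {τ : ℝ} (hτ : 0 < τ) (ω : ℝ) {a : ℝ} (ha : 0 < a) (r : ℝ) :
    (∫ t in Set.Ioi (0 : ℝ), (Real.exp (-t * τ) : ℂ) * Complex.exp (-Complex.I * t * ω) *
      ((Real.sin (t * a) / a : ℝ) : ℂ) * Complex.exp (-Complex.I * t * r)).im =
    (P τ (ω + r + a) - P τ (ω + r - a)) / (2 * a) := by
  set c1 : ℂ := -(τ + I * ((ω + r - a : ℝ) : ℂ)) with hc1
  set c2 : ℂ := -(τ + I * ((ω + r + a : ℝ) : ℂ)) with hc2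
  have r1 : c1.re < 0 := by simp [hc1, hτ]
  have r2 : c2.re < 0 := by simp [hc2, hτ]
  have ha' : (a : ℂ) ≠ 0 := by exact_mod_cast ha.ne'
  have : ∀ t : ℝ, (Real.exp (-t * τ) : ℂ) * Complex.exp (-Complex.I * t * ω) *
      ((Real.sin (t * a) / a : ℝ) : ℂ) * Complex.exp (-Complex.I * t * r) =
      (I / (2 * a)) * (Complex.exp (c2 * t) - Complex.exp (c1 * t)) := by
    intro t
    have e1 : c1 * t = (-t * τ : ℝ) + (-I * t * ω) + (t * a * I) + (-I * t * r) := by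
      rw [hc1]; push_cast; ring
    have e2 : c2 * t = (-t * τ : ℝ) + (-I * t * ω) + (-(t * a) * I) + (-I * t * r) := by
      rw [hc2]; push_cast; ring
    rw [e1, e2]
    simp only [Complex.exp_add]
    push_cast
    rw [Complex.sin]
    field_simp
  simp_rw [this]
  rw [integral_const_mul, integral_sub (integrableOn_exp_mul_complex_Ioi r2 0)
    (integrableOn_exp_mul_complex_Ioi r1 0), integral_exp_mul_complex_Ioi r1,
    integral_exp_mul_complex_Ioi r2]
  have hre : ∀ x : ℝ, (-Complex.exp (-(τ + I * (x : ℂ)) * (0 : ℝ)) / (-(τ + I * (x : ℂ)))).re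
      = P τ x := by
    intro x
    simp only [ofReal_zero, mul_zero, Complex.exp_zero, neg_div_neg_eq]
    simp [Complex.normSq_apply, P, pow_two]
  have hI : (I / (2 * a) : ℂ) = ((1 / (2 * a) : ℝ) : ℂ) * I := by
    push_cast; ring
  rw [hI, mul_assoc, Complex.im_ofReal_mul, Complex.I_mul_im, Complex.sub_re, hc1, hc2, hre, hre]
  ring

lemma fubini (g : ℝ → ℝ) (hgint : Integrable g) {τ : ℝ} (hτ : 0 < τ) (ω ξ : ℝ) :
    penroseM g τ ω ξ = ((2 * π : ℝ) ^ (-(1 : ℝ) / 2) : ℝ) *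
      ∫ r : ℝ, (g r : ℂ) * ∫ t in Set.Ioi (0 : ℝ), (Real.exp (-t * τ) : ℂ) *
        Complex.exp (-Complex.I * t * ω) *
      ((Real.sin (t * |ξ|) / |ξ| : ℝ) : ℂ) * Complex.exp (-Complex.I * t * r) := by
  unfold penroseM fhat
  set A : ℝ → ℂ := fun t => (Real.exp (-t * τ) : ℂ) * Complex.exp (-Complex.I * t * ω) *
      ((Real.sin (t * |ξ|) / |ξ| : ℝ) : ℂ) with hA
  set C : ℂ := (((2 * π : ℝ) ^ (-(1 : ℝ) / 2) : ℝ) : ℂ)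
  have hAint : IntegrableOn A (Set.Ioi 0) := by
    have h0 : IntegrableOn (fun t : ℝ => (Real.exp (-τ * t))) (Set.Ioi 0) :=
      integrableOn_exp_mul_Ioi (by linarith) 0
    refine Integrable.mono' (h0.mul_const (1 / |ξ|)) ?_ ?_
    · apply Continuous.aestronglyMeasurable
      simp only [hA]; fun_prop
    · refine Filter.Eventually.of_forall fun t => ?_
      simp only [hA, norm_mul, Complex.norm_real, norm_div]
      have : ‖Complex.exp (-I * t * ω)‖ = 1 := by
        rw [Complex.norm_exp]; simp
      rw [this, mul_one, Real.norm_of_nonneg (Real.exp_pos _).le, Real.norm_eq_abs,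
        Real.norm_eq_abs, abs_abs, show -t * τ = -τ * t by ring]
      gcongr
      exact Real.abs_sin_le_one _
  have hint : Integrable (Function.uncurry fun (t r : ℝ) =>
      A t * (g r : ℂ) * Complex.exp (-I * t * r)) ((volume.restrict (Set.Ioi 0)).prod volume) := by
    refine Integrable.mul_bdd (c := 1) (Integrable.mul_prod hAint hgint.ofReal) ?_ ?_
    · apply Continuous.aestronglyMeasurable; fun_prop
    · refine Filter.Eventually.of_forall fun t => ?_
      rw [Complex.norm_exp]; simp
  calc ∫ t in Set.Ioi (0 : ℝ), A t * (C * ∫ r : ℝ, (g r : ℂ) * Complex.exp (-I * t * r))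
      = ∫ t in Set.Ioi (0 : ℝ), C * ∫ r : ℝ, A t * (g r : ℂ) * Complex.exp (-I * t * r) := by
        congr 1; ext t
        rw [mul_left_comm, ← integral_const_mul]
        simp only [mul_assoc]
    _ = C * ∫ r : ℝ, ∫ t in Set.Ioi (0 : ℝ), A t * (g r : ℂ) * Complex.exp (-I * t * r) := by
        rw [integral_const_mul, integral_integral_swap hint]
    _ = _ := by
        congr 2; ext r
        rw [← integral_const_mul]
        congr 1; ext t; ring

lemma im_step (g : ℝ → ℝ) (hgeven : ∀ r, g (-r) = g r) (hgint : Integrable g)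
    {τ : ℝ} (hτ : 0 < τ) (ω : ℝ) {ξ : ℝ} (hξ : ξ ≠ 0) :
    (penroseM g τ ω ξ).im = (2 * π : ℝ) ^ (-(1 : ℝ) / 2) * (-(2 / |ξ|)) *
      ∫ r in Set.Ioi (0 : ℝ), g r * (ph τ ω (|ξ| + r) + ph τ ω (|ξ| - r)) := by
  have ha : 0 < |ξ| := abs_pos.2 hξ
  rw [fubini g hgint hτ, Complex.im_ofReal_mul, mul_assoc]
  congr 1
  set Kf : ℝ → ℂ := fun r => ∫ t in Set.Ioi (0 : ℝ), (Real.exp (-t * τ) : ℂ) *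
        Complex.exp (-Complex.I * t * ω) *
      ((Real.sin (t * |ξ|) / |ξ| : ℝ) : ℂ) * Complex.exp (-Complex.I * t * r) with hK
  set a := |ξ|
  set q : ℝ → ℝ := fun r => (P τ (ω + r + a) - P τ (ω + r - a)) / (2 * a) with hq
  have hPc : Continuous (P τ) := by
    unfold P
    exact Continuous.div (by fun_prop) (by fun_prop) fun z => (den_pos hτ z).ne'
  have hqc : Continuous q := by simp only [hq]; fun_prop
  have hKim : ∀ r, (Kf r).im = q r := fun r => kernel_im hτ ω ha r
  have hgK : Integrable fun r => (g r : ℂ) * Kf r := by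
    have hKm : AEStronglyMeasurable Kf volume := by
      apply MeasureTheory.StronglyMeasurable.aestronglyMeasurable
      refine StronglyMeasurable.integral_prod_right (ν := volume.restrict (Set.Ioi (0:ℝ)))
        (f := fun (r t : ℝ) => (Real.exp (-t * τ) : ℂ) *
        Complex.exp (-Complex.I * t * ω) *
      ((Real.sin (t * a) / a : ℝ) : ℂ) * Complex.exp (-Complex.I * t * r)) ?_
      apply Continuous.stronglyMeasurable
      fun_prop
    have h0 : IntegrableOn (fun t : ℝ => (Real.exp (-τ * t))) (Set.Ioi 0) :=
      integrableOn_exp_mul_Ioi (by linarith) 0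
    refine Integrable.mul_bdd (c := ∫ t in Set.Ioi (0:ℝ), Real.exp (-τ * t) * (1 / a)) hgint.ofReal hKm ?_
    refine Filter.Eventually.of_forall fun r => ?_
    refine norm_integral_le_of_norm_le (h0.mul_const _) ?_
    refine Filter.Eventually.of_forall fun t => ?_
    simp only [norm_mul, Complex.norm_real, norm_div]
    have : ∀ x : ℝ, ‖Complex.exp (-I * t * x)‖ = 1 := by
      intro x; rw [Complex.norm_exp]; simp
    rw [this, this, mul_one, mul_one, Real.norm_of_nonneg (Real.exp_pos _).le, Real.norm_eq_abs,
        Real.norm_of_nonneg ha.le, show -t * τ = -τ * t by ring]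
    gcongr
    exact Real.abs_sin_le_one _
  have him : (∫ r, (g r : ℂ) * Kf r).im = ∫ r, g r * q r := by
    have := integral_im hgK
    simp only [RCLike.im_to_complex] at this
    rw [← this]
    congr 1; ext r
    rw [Complex.im_ofReal_mul, hKim]
  have hgq : Integrable fun r => g r * q r := by
    have := hgK.im
    refine this.congr (Filter.Eventually.of_forall fun r => ?_)
    simp only [RCLike.im_to_complex]
    rw [Complex.im_ofReal_mul, hKim]
  rw [him, ← integral_add_compl (measurableSet_Ioi (a := (0:ℝ))) hgq, Set.compl_Ioi]
  have hneg := integral_comp_neg_Ioi (0:ℝ) (fun r => g r * q r)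
  rw [neg_zero] at hneg
  have hgq' : Integrable fun r => g (-r) * q (-r) := hgq.comp_neg
  rw [← hneg, ← integral_add hgq.integrableOn hgq'.integrableOn, ← integral_const_mul]
  congr 1; ext r
  rw [hgeven, ph_eq hτ, ph_eq hτ]
  simp only [hq]
  rw [show ω + r + a = ω + (a + r) by ring, show ω + r - a = ω - (a - r) by ring,
    show ω + -r + a = ω + (a - r) by ring, show ω + -r - a = ω - (a + r) by ring]
  field_simp
  ring

lemma ibp (g : ℝ → ℝ) (hg0 : ∀ r, 0 ≤ g r) (hgint : Integrable g)
    (hgdiff : ∀ r ∈ Set.Ioi (0 : ℝ), DifferentiableAt ℝ g r)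
    (hgderiv_neg : ∀ r ∈ Set.Ioi (0 : ℝ), deriv g r < 0)
    {τ : ℝ} (hτ : 0 < τ) (ω : ℝ) {a : ℝ} (ha : 0 < a)
    (hI : IntegrableOn (fun r => deriv g r * Ph τ ω a r) (Set.Ioi (0 : ℝ))) :
    ∫ r in Set.Ioi (0 : ℝ), g r * (ph τ ω (a + r) + ph τ ω (a - r)) =
      - ∫ r in Set.Ioi (0 : ℝ), deriv g r * Ph τ ω a r := by
  have hanti : AntitoneOn g (Set.Ioi 0) := by
    refine antitoneOn_of_deriv_nonpos (convex_Ioi 0)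
      (fun r hr => (hgdiff r hr).continuousAt.continuousWithinAt) ?_ ?_
    · rw [interior_Ioi]; exact fun r hr => (hgdiff r hr).differentiableWithinAt
    · rw [interior_Ioi]; exact fun r hr => (hgderiv_neg r hr).le
  have hii : ∀ x y, IntervalIntegrable g volume x y := fun x y => hgint.intervalIntegrable
  have hrg : ∀ r, 0 < r → r * g r ≤ ∫ s in (0:ℝ)..r, g s := by
    intro r hr
    have : ∫ s in (0:ℝ)..r, g r = r * g r := by simp
    rw [← this]
    refine intervalIntegral.integral_mono_on_of_le_Ioo hr.le (by simp) (hii _ _) ?_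
    intro s hs
    exact hanti hs.1 hr hs.2.le
  have h0 : Filter.Tendsto (fun r => ∫ s in (0:ℝ)..r, g s) (nhdsWithin 0 (Set.Ioi 0)) (nhds 0) := by
    have := (intervalIntegral.continuous_primitive hii 0).tendsto 0
    simp only [intervalIntegral.integral_same] at this
    exact this.mono_left nhdsWithin_le_nhds
  have hz : Filter.Tendsto (g * Ph τ ω a) (nhdsWithin 0 (Set.Ioi 0)) (nhds 0) := by
    have h1 := h0.const_mul (2 / τ)
    rw [mul_zero] at h1
    refine squeeze_zero_norm' ?_ h1
    filter_upwards [self_mem_nhdsWithin] with r hr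
    have hr : 0 < r := hr
    rw [Pi.mul_apply, norm_mul, Real.norm_of_nonneg (hg0 r)]
    calc g r * ‖Ph τ ω a r‖ ≤ g r * (1 / τ * (2 * r)) :=
          mul_le_mul_of_nonneg_left (Ph_bd2 hτ ω a hr) (hg0 r)
      _ = 2 / τ * (r * g r) := by ring
      _ ≤ _ := by gcongr; exact hrg r hr
  have hinf : Filter.Tendsto (g * Ph τ ω a) Filter.atTop (nhds 0) := by
    have h1 : Filter.Tendsto (fun r : ℝ => (1 / τ * (2 * a) * ∫ s, g s) * r⁻¹) Filter.atTop (nhds 0) := by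
      have := tendsto_inv_atTop_zero (𝕜 := ℝ) |>.const_mul (1 / τ * (2 * a) * ∫ s, g s)
      rwa [mul_zero] at this
    refine squeeze_zero_norm' ?_ h1
    filter_upwards [Filter.eventually_gt_atTop 0] with r hr
    rw [Pi.mul_apply, norm_mul, Real.norm_of_nonneg (hg0 r)]
    have h2 : g r ≤ (∫ s, g s) * r⁻¹ := by
      rw [← div_eq_mul_inv, le_div_iff₀ hr, mul_comm]
      refine (hrg r hr).trans ?_
      rw [intervalIntegral.integral_of_le hr.le]
      exact setIntegral_le_integral hgint (Filter.Eventually.of_forall hg0)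
    calc g r * ‖Ph τ ω a r‖ ≤ ((∫ s, g s) * r⁻¹) * (1 / τ * (2 * a)) :=
          mul_le_mul h2 (Ph_bd1 hτ ω ha r) (norm_nonneg _) ((hg0 r).trans h2)
      _ = _ := by ring
  have hguv : IntegrableOn (g * fun r => (ph τ ω (a + r) + ph τ ω (a - r))) (Set.Ioi 0) := by
    refine Integrable.integrableOn ?_
    refine Integrable.mul_bdd (c := 1 / τ + 1 / τ) hgint ?_ ?_
    · have := ph_cont hτ ω
      apply Continuous.aestronglyMeasurable; fun_prop
    · refine Filter.Eventually.of_forall fun r => ?_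
      exact (norm_add_le _ _).trans (add_le_add (ph_bd hτ _ _) (ph_bd hτ _ _))
  have := integral_Ioi_mul_deriv_eq_deriv_mul (u := g) (v := Ph τ ω a) (u' := deriv g)
    (v' := fun r => (ph τ ω (a + r) + ph τ ω (a - r))) (a := 0)
    (fun r hr => (hgdiff r hr).hasDerivAt) (fun r _ => Ph_deriv hτ ω a r) hguv hI hz hinf
  rw [this]; simp

end PenroseAux

/-- one-dimensional quantum Penrose computation. Let `g : ℝ → [0,∞)` be
even and integrable, with `g' = deriv g` continuous and strictly negative on `(0,∞)`.
Then for `τ > 0`, `ω ∈ ℝ`, `ξ ≠ 0`,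
`Im m(τ,ω,ξ) = (2/(|ξ|√(2π))) ∫₀^∞ g'(r) ∫_{||ξ|-r|}^{r+|ξ|} (τωz)/((τ²+(ω+z)²)(τ²+(ω-z)²)) dz dr`;
in particular `Im m(τ,ω,ξ) ≠ 0` whenever `τ > 0`, `ω ≠ 0`, `ξ ≠ 0`. -/
theorem penrose_im_formula (g : ℝ → ℝ) (hg0 : ∀ r, 0 ≤ g r)
    (hgeven : ∀ r, g (-r) = g r) (hgint : Integrable g)
    (hgdiff : ∀ r ∈ Set.Ioi (0 : ℝ), DifferentiableAt ℝ g r)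
    (hgderiv_cont : ContinuousOn (deriv g) (Set.Ioi (0 : ℝ)))
    (hgderiv_neg : ∀ r ∈ Set.Ioi (0 : ℝ), deriv g r < 0)
    (τ ω ξ : ℝ) (hτ : 0 < τ) (hξ : ξ ≠ 0)
    (hm_int : IntegrableOn
      (fun t => (Real.exp (-t * τ) : ℂ) * Complex.exp (-Complex.I * t * ω) *
        ((Real.sin (t * |ξ|) / |ξ| : ℝ) : ℂ) * fhat g t) (Set.Ioi (0 : ℝ)))
    (hrhs_int : IntegrableOn (fun r => deriv g r * penroseInner τ ω ξ r)
      (Set.Ioi (0 : ℝ))) :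
    (penroseM g τ ω ξ).im =
      (2 / (|ξ| * Real.sqrt (2 * π))) *
        ∫ r in Set.Ioi (0 : ℝ), deriv g r * penroseInner τ ω ξ r ∧
    (ω ≠ 0 → (penroseM g τ ω ξ).im ≠ 0) := by
  have ha : 0 < |ξ| := abs_pos.2 hξ
  have hcongr : ∀ r ∈ Set.Ioi (0:ℝ), deriv g r * penroseInner τ ω ξ r =
      deriv g r * PenroseAux.Ph τ ω |ξ| r := fun r hr => by
    rw [PenroseAux.inner_eq hτ ω ξ hr]
  have hI : IntegrableOn (fun r => deriv g r * PenroseAux.Ph τ ω |ξ| r) (Set.Ioi (0 : ℝ)) :=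
    hrhs_int.congr_fun hcongr measurableSet_Ioi
  have hpi : (0:ℝ) < 2 * π := by positivity
  have hmain : (penroseM g τ ω ξ).im =
      (2 / (|ξ| * Real.sqrt (2 * π))) *
        ∫ r in Set.Ioi (0 : ℝ), deriv g r * penroseInner τ ω ξ r := by
    rw [PenroseAux.im_step g hgeven hgint hτ ω hξ,
      PenroseAux.ibp g hg0 hgint hgdiff hgderiv_neg hτ ω ha hI,
      setIntegral_congr_fun measurableSet_Ioi hcongr, neg_div, Real.rpow_neg hpi.le,
      ← Real.sqrt_eq_rpow]
    have := (Real.sqrt_pos.2 hpi).ne'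
    field_simp
  refine ⟨hmain, fun hω => ?_⟩
  rw [hmain]
  refine mul_ne_zero (by have := Real.sqrt_pos.2 hpi; positivity) ?_
  rw [setIntegral_congr_fun measurableSet_Ioi hcongr]
  intro h0
  have hpos : ∀ r ∈ Set.Ioi (0:ℝ), 0 < -ω * (deriv g r * PenroseAux.Ph τ ω |ξ| r) := by
    intro r hr
    have h1 := PenroseAux.Ph_pos hτ hω ha hr
    have h2 := mul_pos (neg_pos.2 (hgderiv_neg r hr)) h1
    linarith
  have h3 : 0 < ∫ r in Set.Ioi (0 : ℝ), -ω * (deriv g r * PenroseAux.Ph τ ω |ξ| r) := by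
    rw [setIntegral_pos_iff_support_of_nonneg_ae
      ((ae_restrict_iff' measurableSet_Ioi).2 (Filter.Eventually.of_forall fun r hr => (hpos r hr).le))
      (hI.const_mul _)]
    have hsub : Set.Ioi (0:ℝ) ⊆ Function.support
        (fun r => -ω * (deriv g r * PenroseAux.Ph τ ω |ξ| r)) := fun r hr => (hpos r hr).ne'
    rw [Set.inter_eq_self_of_subset_right hsub]
    simp
  rw [integral_const_mul, h0, mul_zero] at h3
  exact lt_irrefl _ h3
end
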